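/- Let G be a finite simple graph and v ∈ V(G) a vertex having at least one leaf-neighbor, and let L(v) denote the set of leaf-neighbors of v. If G' is the subgraph of G induced by V(G) \ ({v} ∪ L(v)), then γ_gr^t(G) = γ_gr^t(G') + 2. -/

import Mathlib

/-- `s` is a legal (open neighborhood) sequence in `G`. -/
def IsLegalSeq {V : Type*} (G : SimpleGraph V) (s : List V) : Prop :=
  s.Nodup ∧ ∀ i : Fin s.length, ∃ w : V, G.Adj (s.get i) w ∧
    ∀ j : Fin s.length, (j : ℕ) < (i : ℕ) → ¬ G.Adj (s.get j) w

/-- The Grundy total domination number: the maximum length of a legal sequence. -/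
noncomputable def grundyTotal {V : Type*} (G : SimpleGraph V) : ℕ :=
  sSup {n | ∃ s : List V, IsLegalSeq G s ∧ s.length = n}

/-- The set of leaf-neighbors of `v`: vertices whose unique neighbor is `v`. -/
def leafNeighbors {V : Type*} (G : SimpleGraph V) (v : V) : Set V :=
  {u | G.neighborSet u = {v}}

/-- A sequence is legal iff its vertices admit footprints `f x`: each `x` is adjacent to `f x`, and
no earlier vertex is. -/
theorem isLegalSeq_iff_exists_footprint {V : Type*} (G : SimpleGraph V) (s : List V) :
    IsLegalSeq G s ↔
      ∃ f : V → V, (∀ x ∈ s, G.Adj x (f x)) ∧ s.Pairwise fun a b => ¬ G.Adj a (f b) := by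
  constructor
  · rintro ⟨hnd, h⟩
    choose w hw hw' using h
    have hf : ∀ x, ∃ y, ∀ i : Fin s.length, s.get i = x → w i = y := by
      intro x
      by_cases hx : ∃ i, s.get i = x
      · obtain ⟨i, rfl⟩ := hx
        exact ⟨w i, fun j hj => by rw [hnd.injective_get hj]⟩
      · exact ⟨x, fun i hi => (hx ⟨i, hi⟩).elim⟩
    choose f hf using hf
    refine ⟨f, fun x hx => ?_, List.pairwise_iff_get.2 fun i j hij => ?_⟩
    · obtain ⟨i, rfl⟩ := List.get_of_mem hx
      rw [← hf _ i rfl]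
      exact hw i
    · rw [← hf _ j rfl]
      exact hw' j i hij
  · rintro ⟨f, hadj, hpw⟩
    refine ⟨(List.Pairwise.and_mem.1 hpw).imp ?_, fun i => ⟨f (s.get i), hadj _ (List.get_mem _ _), ?_⟩⟩
    · rintro a _ ⟨ha, -, hab⟩ rfl
      exact hab (hadj a ha)
    · exact fun j hji => List.pairwise_iff_get.1 hpw j i hji

theorem bddAbove_length_isLegalSeq {V : Type*} [Finite V] (G : SimpleGraph V) :
    BddAbove {n | ∃ s : List V, IsLegalSeq G s ∧ s.length = n} := by
  have := Fintype.ofFinite V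
  refine ⟨Fintype.card V, ?_⟩
  rintro _ ⟨s, hs, rfl⟩
  exact hs.1.length_le_card

theorem IsLegalSeq.length_le_grundyTotal {V : Type*} [Finite V] {G : SimpleGraph V} {s : List V}
    (hs : IsLegalSeq G s) : s.length ≤ grundyTotal G :=
  le_csSup (bddAbove_length_isLegalSeq G) ⟨s, hs, rfl⟩

theorem exists_isLegalSeq_length_eq_grundyTotal {V : Type*} [Finite V] (G : SimpleGraph V) :
    ∃ s : List V, IsLegalSeq G s ∧ s.length = grundyTotal G :=
  Nat.sSup_mem (s := {n | ∃ s : List V, IsLegalSeq G s ∧ s.length = n})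
    ⟨0, [], ⟨List.nodup_nil, fun i => Fin.elim0 i⟩, rfl⟩
    (bddAbove_length_isLegalSeq G)

theorem adj_iff_of_mem_leafNeighbors {V : Type*} {G : SimpleGraph V} {u v : V}
    (hu : u ∈ leafNeighbors G v) (w : V) : G.Adj u w ↔ w = v := by
  rw [← SimpleGraph.mem_neighborSet, show G.neighborSet u = {v} from hu, Set.mem_singleton_iff]

/-- A legal sequence avoiding a support vertex and its leaves extends by a leaf in front and the
support vertex at the end. -/
theorem IsLegalSeq.extend_by_leaf_and_support {V : Type*} {G : SimpleGraph V} {u v : V}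
    (hu : u ∈ leafNeighbors G v) {s : List ↥({v} ∪ leafNeighbors G v)ᶜ}
    (hs : IsLegalSeq (G.induce ({v} ∪ leafNeighbors G v)ᶜ) s) :
    IsLegalSeq G (u :: (s.map Subtype.val ++ [v])) := by
  classical
  obtain ⟨g, hg, hpw⟩ := (isLegalSeq_iff_exists_footprint _ s).1 hs
  have hadj := adj_iff_of_mem_leafNeighbors hu
  have huv : u ≠ v := ((hadj v).2 rfl).ne
  let f : V → V := fun x =>
    if h : x ∈ ({v} ∪ leafNeighbors G v)ᶜ then (g ⟨x, h⟩ : V) else if x = v then u else v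
  have hfu : f u = v := by simp [f, hu, huv]
  have hfv : f v = u := by simp [f]
  have hfs : ∀ x : ↥({v} ∪ leafNeighbors G v)ᶜ, f x = g x := fun x => dif_pos x.2
  have hne : ∀ x : ↥({v} ∪ leafNeighbors G v)ᶜ, (x : V) ≠ v := fun x h => x.2 (Or.inl h)
  refine (isLegalSeq_iff_exists_footprint _ _).2 ⟨f, ?_, ?_⟩
  · intro x hx
    simp only [List.mem_cons, List.mem_append, List.mem_map, List.not_mem_nil, or_false] at hx
    rcases hx with rfl | ⟨y, hy, rfl⟩ | rfl
    · rw [hfu, hadj]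
    · rw [hfs]
      exact hg y hy
    · rw [hfv, G.adj_comm, hadj]
  · rw [List.pairwise_cons, List.pairwise_append, List.pairwise_map]
    refine ⟨fun x hx => ?_, hpw.imp fun {a b} hab => ?_, List.pairwise_singleton _ _, ?_⟩
    · simp only [List.mem_append, List.mem_map, List.mem_singleton] at hx
      rw [hadj]
      rcases hx with ⟨y, -, rfl⟩ | rfl
      · rw [hfs]
        exact hne _
      · rwa [hfv]
    · rw [hfs]
      exact hab
    · intro a ha b hb
      obtain ⟨y, -, rfl⟩ := List.mem_map.1 ha
      rw [List.mem_singleton.1 hb, hfv, G.adj_comm, hadj]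
      exact hne y

/-- A legal sequence becomes legal in the graph without a vertex `v` and its leaves after dropping
at most two of its vertices, namely `v` and the vertex footprinting `v`. -/
theorem IsLegalSeq.exists_induce_compl {V : Type*} {G : SimpleGraph V} (v : V) {s : List V}
    (hs : IsLegalSeq G s) :
    ∃ t, IsLegalSeq (G.induce ({v} ∪ leafNeighbors G v)ᶜ) t ∧ s.length ≤ t.length + 2 := by
  classical
  obtain ⟨f, hf, hpw⟩ := (isLegalSeq_iff_exists_footprint _ s).1 hs
  have huniq : ∀ a ∈ s, ∀ b ∈ s, f a = v → f b = v → a = b := by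
    have hpw' : s.Pairwise fun a b => f a = v → f b = v → a = b := by
      refine (List.Pairwise.and_mem.1 hpw).imp fun {a b} h ha hb => (h.2.2 ?_).elim
      rw [hb, ← ha]
      exact hf a h.1
    have : Std.Symm fun a b => f a = v → f b = v → a = b := ⟨fun _ _ h hb ha => (h ha hb).symm⟩
    exact fun a ha b hb => hpw'.forall_of_forall (fun _ _ _ _ => rfl) ha hb
  have hdrop : (s.filter fun x => ¬ (x ≠ v ∧ f x ≠ v)).length ≤ 2 := by
    obtain ⟨c, hc⟩ : ∃ c, ∀ x ∈ s, f x = v → x = c := by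
      by_cases h : ∃ c ∈ s, f c = v
      · obtain ⟨c, hc, hcv⟩ := h
        exact ⟨c, fun x hx hxv => huniq x hx c hc hxv hcv⟩
      · exact ⟨v, fun x hx hxv => (h ⟨x, hx, hxv⟩).elim⟩
    refine ((hs.1.filter _).subperm (l₂ := [v, c]) fun x hx => ?_).length_le
    simp only [List.mem_filter, decide_eq_true_eq] at hx
    have := hc x hx.1
    simp only [List.mem_cons, List.not_mem_nil, or_false]
    tauto
  have hmem : ∀ x ∈ s.filter (fun x => x ≠ v ∧ f x ≠ v),
      x ∈ ({v} ∪ leafNeighbors G v)ᶜ ∧ f x ∈ ({v} ∪ leafNeighbors G v)ᶜ := by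
    intro x hx
    simp only [List.mem_filter, decide_eq_true_eq] at hx
    obtain ⟨hxs, hxv, hfxv⟩ := hx
    have hadj := hf x hxs
    constructor
    · rintro (h | h)
      · exact hxv h
      · exact hfxv ((adj_iff_of_mem_leafNeighbors h _).1 hadj)
    · rintro (h | h)
      · exact hfxv h
      · exact hxv ((adj_iff_of_mem_leafNeighbors h _).1 hadj.symm)
  have hlen : s.length = (s.filter fun x => x ≠ v ∧ f x ≠ v).length +
      (s.filter fun x => ¬ (x ≠ v ∧ f x ≠ v)).length := by
    simpa using List.length_eq_length_filter_add (l := s) fun x => decide (x ≠ v ∧ f x ≠ v)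
  have hpwt := hpw.filter fun x => decide (x ≠ v ∧ f x ≠ v)
  have hft : ∀ x ∈ s.filter (fun x => x ≠ v ∧ f x ≠ v), G.Adj x (f x) :=
    fun x hx => hf x (List.mem_of_mem_filter hx)
  generalize s.filter (fun x => x ≠ v ∧ f x ≠ v) = t at hmem hlen hpwt hft
  lift t to List ↥({v} ∪ leafNeighbors G v)ᶜ using fun x hx => (hmem x hx).1
  have hg : ∀ x : ↥({v} ∪ leafNeighbors G v)ᶜ, ∃ y : ↥({v} ∪ leafNeighbors G v)ᶜ,
      x ∈ t → (y : V) = f x := by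
    intro x
    by_cases hx : x ∈ t
    · exact ⟨⟨f x, (hmem x (List.mem_map_of_mem hx)).2⟩, fun _ => rfl⟩
    · exact ⟨x, fun h => (hx h).elim⟩
  choose g hg using hg
  refine ⟨t, (isLegalSeq_iff_exists_footprint _ _).2 ⟨g, fun x hx => ?_, ?_⟩, ?_⟩
  · rw [SimpleGraph.comap_adj, Function.Embedding.subtype_apply, Function.Embedding.subtype_apply,
      hg x hx]
    exact hft x (List.mem_map_of_mem hx)
  · refine (List.Pairwise.and_mem.1 (List.pairwise_map.1 hpwt)).imp fun {a b} h => ?_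
    rw [SimpleGraph.comap_adj, Function.Embedding.subtype_apply, Function.Embedding.subtype_apply,
      hg b h.2.1]
    exact h.2.2
  · rw [List.length_map] at hlen
    lia

theorem grundyTotal_delete_support_and_leaves {V : Type*} [Fintype V]
    (G : SimpleGraph V) (v : V) (hleaf : (leafNeighbors G v).Nonempty) :
    grundyTotal G = grundyTotal (G.induce ({v} ∪ leafNeighbors G v)ᶜ) + 2 := by
  obtain ⟨u, hu⟩ := hleaf
  apply le_antisymm
  · obtain ⟨s, hs, hlen⟩ := exists_isLegalSeq_length_eq_grundyTotal G
    obtain ⟨t, ht, hst⟩ := hs.exists_induce_compl v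
    have := ht.length_le_grundyTotal
    lia
  · obtain ⟨s, hs, hlen⟩ :=
      exists_isLegalSeq_length_eq_grundyTotal (G.induce ({v} ∪ leafNeighbors G v)ᶜ)
    have := (hs.extend_by_leaf_and_support hu).length_le_grundyTotal
    simp only [List.length_cons, List.length_append, List.length_map, List.length_nil] at this
    lia
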